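/- arXiv:2003.09955 — 3 statements merged into one kernel-verified Lean document; each statement's English description precedes it below -/
import Mathlib

section
/- Assuming the Weil bound |S(m,n;q)| ≤ τ(q)·√((m,n,q)·q) for all (m,n) ≠ (0,0), one has |μ_q(B) − vol(B)| → 0 as q → ∞ for every ball B in 𝕋², where μ_q is the uniform probability measure on {(d/q, d⁻¹/q) : d ∈ (ℤ/qℤ)ˣ}. -/
open MeasureTheory Filter Real Complex Finset

noncomputable def kloostermanS (q : ℕ) (m n : ℤ) : ℂ :=
  ∑ d ∈ (Finset.range q).filter (fun d => Nat.Coprime d q),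
    Complex.exp (2 * Real.pi * Complex.I *
      (((m * d + n * (((d : ZMod q)⁻¹).val : ℤ) : ℤ) : ℂ) / q))

abbrev Torus2 : Type := AddCircle (1 : ℝ) × AddCircle (1 : ℝ)

noncomputable def torusPt (q d : ℕ) : Torus2 :=
  (↑((d : ℝ) / q), ↑(((((d : ZMod q)⁻¹).val : ℕ) : ℝ) / q))

noncomputable def muQ (q : ℕ) : Measure Torus2 :=
  ((q.totient : ENNReal))⁻¹ •
    ∑ d ∈ (Finset.range q).filter (fun d => Nat.Coprime d q), Measure.dirac (torusPt q d)

/-- The geodesic (Euclidean) ball of radius `R` centred at `y` on the torus. -/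
noncomputable def torusBall (y : Torus2) (R : ℝ) : Set Torus2 :=
  {x : Torus2 | (dist x.1 y.1) ^ 2 + (dist x.2 y.2) ^ 2 < R ^ 2}

lemma exists_card_divisors_pow_le (k : ℕ) :
    ∃ C : ℕ, ∀ n : ℕ, n ≠ 0 → n.divisors.card ^ k ≤ C * n := by
  obtain ⟨C, hC1, hC⟩ : ∃ C : ℕ, 1 ≤ C ∧ ∀ a : ℕ, (a + 1) ^ k ≤ C * 2 ^ a := by
    have h := tendsto_pow_const_div_const_pow_of_one_lt k (r := 2) one_lt_two
    have h2 := (h.comp (tendsto_add_atTop_nat 1)).bddAbove_range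
    obtain ⟨B, hB⟩ := h2
    refine ⟨⌈B * 2⌉₊ + 1, by omega, fun a => ?_⟩
    have h3 : ((a + 1 : ℕ) : ℝ) ^ k / 2 ^ (a + 1) ≤ B := hB ⟨a, rfl⟩
    rw [div_le_iff₀ (by positivity)] at h3
    have h4 := Nat.le_ceil (B * 2)
    have h5 : ((a + 1 : ℕ) : ℝ) ^ k ≤ ((⌈B * 2⌉₊ + 1 : ℕ) : ℝ) * 2 ^ a := by
      calc _ ≤ B * 2 * 2 ^ a := by rw [pow_succ] at h3; linarith
        _ ≤ _ := by gcongr; push_cast; linarith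
    exact_mod_cast h5
  refine ⟨C ^ 2 ^ k, fun n hn => ?_⟩
  calc n.divisors.card ^ k = ∏ p ∈ n.primeFactors, (n.factorization p + 1) ^ k := by
        rw [Nat.card_divisors hn, Finset.prod_pow]
    _ ≤ ∏ p ∈ n.primeFactors, ((if p < 2 ^ k then C else 1) * p ^ n.factorization p) := by
        refine Finset.prod_le_prod' fun p hp => ?_
        have hp2 := (Nat.prime_of_mem_primeFactors hp).two_le
        split_ifs with h
        · exact (hC _).trans (by gcongr)
        · push Not at h
          calc (n.factorization p + 1) ^ k ≤ (2 ^ n.factorization p) ^ k := by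
                gcongr; exact Nat.lt_two_pow_self
            _ = (2 ^ k) ^ n.factorization p := by rw [← pow_mul, ← pow_mul, mul_comm]
            _ ≤ 1 * p ^ n.factorization p := by rw [one_mul]; gcongr
    _ = C ^ (n.primeFactors.filter (· < 2 ^ k)).card * n := by
        rw [Finset.prod_mul_distrib, ← Finset.prod_filter, Finset.prod_const]
        congr 1
        exact Nat.prod_factorization_pow_eq_self hn
    _ ≤ C ^ 2 ^ k * n := by
        gcongr
        calc _ ≤ (Finset.range (2 ^ k)).card :=
              Finset.card_le_card fun p hp => by simpa using (Finset.mem_filter.1 hp).2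
          _ = _ := Finset.card_range _

lemma le_totient_mul_card_divisors (n : ℕ) : n ≤ n.totient * n.divisors.card := by
  rcases Nat.eq_zero_or_pos n with rfl | hn
  · simp
  calc n = ∑ d ∈ n.divisors, d.totient := (Nat.sum_totient n).symm
    _ ≤ ∑ _d ∈ n.divisors, n.totient := Finset.sum_le_sum fun d hd =>
        Nat.le_of_dvd (Nat.totient_pos.2 hn) (Nat.totient_dvd_of_dvd (Nat.dvd_of_mem_divisors hd))
    _ = _ := by rw [Finset.sum_const, smul_eq_mul, mul_comm]

lemma volume_addCircle_sphere (c : AddCircle (1 : ℝ)) (r : ℝ) :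
    volume {x : AddCircle (1 : ℝ) | dist x c = r} = 0 := by
  have hsub : {x : AddCircle (1 : ℝ) | dist x c = r} ⊆
      Metric.closedBall (c + (r : AddCircle (1 : ℝ))) 0 ∪
        Metric.closedBall (c + ((-r : ℝ) : AddCircle (1 : ℝ))) 0 := by
    intro x hx
    obtain ⟨t, ht⟩ := QuotientAddGroup.mk_surjective (x - c)
    have ht' : x - c = ((t - round ((1 : ℝ)⁻¹ * t) * 1 : ℝ) : AddCircle (1 : ℝ)) := by
      rw [← ht, AddCircle.coe_sub]
      have : ((round ((1 : ℝ)⁻¹ * t) * 1 : ℝ) : AddCircle (1 : ℝ)) = 0 :=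
        AddCircle.coe_eq_zero_iff _ |>.2 ⟨round ((1 : ℝ)⁻¹ * t), by simp⟩
      rw [this, sub_zero]
    have hx' : |t - round ((1 : ℝ)⁻¹ * t) * 1| = r := by
      rw [← AddCircle.norm_eq, ← hx.out, dist_eq_norm, ← ht]
    simp only [Metric.closedBall_zero, Set.mem_union, Set.mem_singleton_iff]
    rcases eq_or_eq_neg_of_abs_eq hx' with h | h
    · left; rw [← h, ← ht']; abel
    · right; rw [← h, ← ht']; abel
  refine measure_mono_null hsub (measure_union_null ?_ ?_) <;>
  · rw [AddCircle.volume_closedBall]; simp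

instance isProbabilityMeasure_volume_unitAddCircle :
    IsProbabilityMeasure (volume : Measure (AddCircle (1 : ℝ))) :=
  ⟨by rw [AddCircle.measure_univ, ENNReal.ofReal_one]⟩

instance isProbabilityMeasure_volume_torus2 : IsProbabilityMeasure (volume : Measure Torus2) :=
  inferInstanceAs (IsProbabilityMeasure
    ((volume : Measure (AddCircle (1 : ℝ))).prod (volume : Measure (AddCircle (1 : ℝ)))))

lemma volume_frontier_torusBall (y : Torus2) (R : ℝ) :
    volume (frontier (torusBall y R)) = 0 := by
  have hc : Continuous fun x : Torus2 => (dist x.1 y.1) ^ 2 + (dist x.2 y.2) ^ 2 := by fun_prop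
  refine measure_mono_null (frontier_lt_subset_eq hc continuous_const) ?_
  rw [Measure.volume_eq_prod,
    Measure.measure_prod_null (isClosed_eq hc continuous_const).measurableSet]
  refine Eventually.of_forall fun a => ?_
  refine measure_mono_null (t := {x | dist x y.2 = √(R ^ 2 - dist a y.1 ^ 2)}) ?_
    (volume_addCircle_sphere _ _)
  intro x hx
  have hx' : dist a y.1 ^ 2 + dist x y.2 ^ 2 = R ^ 2 := hx
  change dist x y.2 = √(R ^ 2 - dist a y.1 ^ 2)
  rw [← hx', add_sub_cancel_left, Real.sqrt_sq dist_nonneg]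

/-- The character `(x, y) ↦ e(mx + ny)` of the torus. -/
noncomputable def torusFourier (k : ℤ × ℤ) : C(Torus2, ℂ) where
  toFun x := fourier k.1 x.1 * fourier k.2 x.2
  continuous_toFun := by fun_prop

lemma torusFourier_apply (k : ℤ × ℤ) (x : Torus2) :
    torusFourier k x = fourier k.1 x.1 * fourier k.2 x.2 := rfl

lemma torusFourier_zero : torusFourier 0 = 1 := by
  ext x
  simp [torusFourier_apply]

lemma torusFourier_add (k l : ℤ × ℤ) :
    torusFourier (k + l) = torusFourier k * torusFourier l := by
  ext x
  simp only [torusFourier_apply, Prod.fst_add, Prod.snd_add, fourier_add, ContinuousMap.mul_apply]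
  ring

lemma star_torusFourier (k : ℤ × ℤ) : star (torusFourier k) = torusFourier (-k) := by
  ext x
  simp [torusFourier_apply]

/-- The star subalgebra of trigonometric polynomials on the torus. -/
noncomputable def torusFourierSubalgebra : StarSubalgebra ℂ C(Torus2, ℂ) where
  toSubalgebra := Algebra.adjoin ℂ (Set.range torusFourier)
  star_mem' := by
    change Algebra.adjoin ℂ (Set.range torusFourier) ≤
      star (Algebra.adjoin ℂ (Set.range torusFourier))
    refine Algebra.adjoin_le ?_
    rintro _ ⟨k, rfl⟩
    exact Algebra.subset_adjoin ⟨-k, (star_torusFourier k).symm⟩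

lemma torusFourierSubalgebra_coe :
    torusFourierSubalgebra.toSubalgebra.toSubmodule =
      Submodule.span ℂ (Set.range torusFourier) := by
  apply Algebra.adjoin_eq_span_of_subset
  refine .trans (fun x ↦ Submonoid.closure_induction (fun _ ↦ id) ⟨0, torusFourier_zero⟩ ?_)
    Submodule.subset_span
  rintro _ _ _ _ ⟨k, rfl⟩ ⟨l, rfl⟩
  exact ⟨k + l, torusFourier_add k l⟩

lemma torusFourierSubalgebra_separatesPoints : torusFourierSubalgebra.SeparatesPoints := by
  intro x y hxy
  have hinj := AddCircle.injective_toCircle (T := (1 : ℝ)) one_ne_zero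
  by_cases h : x.1 = y.1
  · refine ⟨_, ⟨torusFourier (0, 1), Algebra.subset_adjoin ⟨(0, 1), rfl⟩, rfl⟩, fun h2 => ?_⟩
    simp only [torusFourier_apply, fourier_zero, one_mul, fourier_one, Circle.coe_inj] at h2
    exact hxy (Prod.ext h (hinj h2))
  · refine ⟨_, ⟨torusFourier (1, 0), Algebra.subset_adjoin ⟨(1, 0), rfl⟩, rfl⟩, fun h2 => ?_⟩
    simp only [torusFourier_apply, fourier_zero, mul_one, fourier_one, Circle.coe_inj] at h2
    exact h (hinj h2)

lemma span_torusFourier_closure_eq_top :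
    (Submodule.span ℂ (Set.range torusFourier)).topologicalClosure = ⊤ := by
  rw [← torusFourierSubalgebra_coe]
  exact congr_arg (Subalgebra.toSubmodule <| StarSubalgebra.toSubalgebra ·)
    (ContinuousMap.starSubalgebra_topologicalClosure_eq_top_of_separatesPoints _
      torusFourierSubalgebra_separatesPoints)

lemma ContinuousMap.integrable_of_compactSpace {X : Type*} [TopologicalSpace X] [CompactSpace X]
    [MeasurableSpace X] [OpensMeasurableSpace X] (μ : Measure X) [IsFiniteMeasure μ]
    (f : C(X, ℂ)) : Integrable f μ :=
  (BoundedContinuousFunction.mkOfCompact f).integrable μ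

lemma norm_integral_sub_le_norm_sub {X : Type*} [TopologicalSpace X] [CompactSpace X]
    [MeasurableSpace X] [OpensMeasurableSpace X] (μ : Measure X) [IsProbabilityMeasure μ]
    (f g : C(X, ℂ)) : ‖∫ x, f x ∂μ - ∫ x, g x ∂μ‖ ≤ ‖f - g‖ := by
  rw [← integral_sub (f.integrable_of_compactSpace μ) (g.integrable_of_compactSpace μ)]
  simpa using norm_integral_le_of_norm_le_const (μ := μ)
    (Eventually.of_forall fun x => (f - g).norm_coe_le_norm x)

/-- Weyl's criterion on the torus. -/
lemma tendsto_of_tendsto_integral_torusFourier {μs : ℕ → ProbabilityMeasure Torus2}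
    {μ : ProbabilityMeasure Torus2}
    (h : ∀ k, Tendsto (fun i => ∫ x, torusFourier k x ∂(μs i : Measure Torus2)) atTop
      (nhds (∫ x, torusFourier k x ∂(μ : Measure Torus2)))) :
    Tendsto μs atTop (nhds μ) := by
  rw [ProbabilityMeasure.tendsto_iff_forall_integral_rclike_tendsto ℂ]
  intro f
  have hspan : ∀ g ∈ Submodule.span ℂ (Set.range torusFourier),
      Tendsto (fun i => ∫ x, g x ∂(μs i : Measure Torus2)) atTop
        (nhds (∫ x, g x ∂(μ : Measure Torus2))) := by
    intro g hg
    induction hg using Submodule.span_induction with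
    | mem g hg => obtain ⟨k, rfl⟩ := hg; exact h k
    | zero => simp
    | add a b _ _ ha hb =>
      simp only [ContinuousMap.add_apply]
      simp_rw [integral_add (a.integrable_of_compactSpace _) (b.integrable_of_compactSpace _)]
      exact ha.add hb
    | smul c a _ ha =>
      simp only [ContinuousMap.smul_apply, integral_smul]
      exact ha.const_smul c
  rw [Metric.tendsto_atTop]
  intro ε hε
  have hf : f.toContinuousMap ∈ closure
      (Submodule.span ℂ (Set.range torusFourier) : Set C(Torus2, ℂ)) := by
    rw [← Submodule.topologicalClosure_coe, span_torusFourier_closure_eq_top]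
    trivial
  obtain ⟨g, hg, hfg⟩ := Metric.mem_closure_iff.1 hf (ε / 3) (by positivity)
  obtain ⟨N, hN⟩ := Metric.tendsto_atTop.1 (hspan g hg) (ε / 3) (by positivity)
  refine ⟨N, fun i hi => ?_⟩
  have h1 := norm_integral_sub_le_norm_sub (μs i : Measure Torus2) f.toContinuousMap g
  have h2 := norm_integral_sub_le_norm_sub (μ : Measure Torus2) f.toContinuousMap g
  rw [← dist_eq_norm, ← dist_eq_norm] at h1 h2
  have h3 := hN i hi
  change dist (∫ x, f.toContinuousMap x ∂(μs i : Measure Torus2))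
    (∫ x, f.toContinuousMap x ∂(μ : Measure Torus2)) < ε
  linarith [dist_triangle4 (∫ x, f.toContinuousMap x ∂(μs i : Measure Torus2))
    (∫ x, g x ∂(μs i : Measure Torus2)) (∫ x, g x ∂(μ : Measure Torus2))
    (∫ x, f.toContinuousMap x ∂(μ : Measure Torus2)),
    dist_comm (∫ x, f.toContinuousMap x ∂(μ : Measure Torus2)) (∫ x, g x ∂(μ : Measure Torus2))]

lemma integral_fourier_eq_zero {n : ℤ} (hn : n ≠ 0) :
    ∫ x : AddCircle (1 : ℝ), fourier n x = 0 :=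
  integral_eq_zero_of_add_right_eq_neg (fourier_add_half_inv_index hn one_pos)

lemma integral_torusFourier_eq_zero {k : ℤ × ℤ} (hk : k ≠ 0) :
    ∫ x, torusFourier k x = 0 := by
  simp only [torusFourier_apply, Measure.volume_eq_prod]
  rw [integral_prod_mul (fun x : AddCircle (1 : ℝ) => (fourier k.1 x : ℂ))
    (fun x : AddCircle (1 : ℝ) => (fourier k.2 x : ℂ))]
  by_cases h1 : k.1 = 0
  · have h2 : k.2 ≠ 0 := fun h2 => hk (Prod.ext h1 h2)
    rw [integral_fourier_eq_zero h2, mul_zero]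
  · rw [integral_fourier_eq_zero h1, zero_mul]

lemma card_filter_coprime_range (q : ℕ) :
    ((Finset.range q).filter (fun d => Nat.Coprime d q)).card = q.totient := by
  simp only [Nat.totient, Nat.coprime_comm]

lemma isProbabilityMeasure_muQ {q : ℕ} (hq : 0 < q) : IsProbabilityMeasure (muQ q) := by
  constructor
  have h : ((q.totient : ℕ) : ENNReal) ≠ 0 := by
    exact_mod_cast (Nat.totient_pos.2 hq).ne'
  simp only [muQ, Measure.smul_apply, Measure.finsetSum_apply, measure_univ, Finset.sum_const,
    card_filter_coprime_range, smul_eq_mul, nsmul_eq_mul, mul_one]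
  exact ENNReal.inv_mul_cancel h (ENNReal.natCast_ne_top _)

lemma torusFourier_torusPt (k : ℤ × ℤ) (q d : ℕ) :
    torusFourier k (torusPt q d) = Complex.exp (2 * Real.pi * Complex.I *
      (((k.1 * d + k.2 * (((d : ZMod q)⁻¹).val : ℤ) : ℤ) : ℂ) / q)) := by
  rw [torusFourier_apply, torusPt, fourier_coe_apply, fourier_coe_apply, ← Complex.exp_add]
  congr 1
  push_cast
  ring

lemma integral_torusFourier_muQ (k : ℤ × ℤ) (q : ℕ) :
    ∫ x, torusFourier k x ∂(muQ q) = (q.totient : ℂ)⁻¹ * kloostermanS q k.1 k.2 := by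
  rw [muQ, integral_smul_measure, integral_finsetSum_measure
    fun d _ => (torusFourier k).integrable_of_compactSpace _]
  simp only [integral_dirac, torusFourier_torusPt, kloostermanS]
  simp

lemma pow_four_norm_inv_totient_mul_le {C q : ℕ} {k : ℤ × ℤ} {S : ℂ} (hk : k ≠ 0) (hq : 0 < q)
    (hC : q.divisors.card ^ 8 ≤ C * q)
    (hS : ‖S‖ ≤ (q.divisors.card : ℝ) *
        Real.sqrt ((Int.gcd (Int.gcd k.1 k.2) (q : ℤ) : ℝ) * q)) :
    ‖(q.totient : ℂ)⁻¹ * S‖ ^ 4 ≤ (Int.gcd k.1 k.2 : ℝ) ^ 2 * C / q := by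
  have hφ : (0 : ℝ) < q.totient := by exact_mod_cast Nat.totient_pos.2 hq
  have hq' : (0 : ℝ) < q := by exact_mod_cast hq
  have hle : (q : ℝ) ≤ q.totient * q.divisors.card := by
    exact_mod_cast le_totient_mul_card_divisors q
  have hC' : (q.divisors.card : ℝ) ^ 8 ≤ C * q := by exact_mod_cast hC
  have hgpos : 0 < Int.gcd k.1 k.2 := by
    rw [Int.gcd_pos_iff]
    by_contra! h
    exact hk (Prod.ext h.1 h.2)
  have hg : (Int.gcd (Int.gcd k.1 k.2) (q : ℤ) : ℝ) ≤ Int.gcd k.1 k.2 := by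
    exact_mod_cast Nat.gcd_le_left _ hgpos
  set τ := (q.divisors.card : ℝ)
  set G := (Int.gcd k.1 k.2 : ℝ)
  have hS4 : ‖S‖ ^ 4 ≤ τ ^ 4 * (G * q) ^ 2 := by
    calc ‖S‖ ^ 4 ≤ (τ * √(G * q)) ^ 4 := by
          gcongr
          exact hS.trans (by gcongr)
      _ = τ ^ 4 * (√(G * q) ^ 2) ^ 2 := by ring
      _ = _ := by rw [Real.sq_sqrt (by positivity)]
  rw [norm_mul, norm_inv, Complex.norm_natCast, mul_pow, inv_pow, inv_mul_eq_div,
    div_le_div_iff₀ (by positivity) hq']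
  have h4 : (q : ℝ) ^ 4 ≤ (q.totient * τ) ^ 4 := by gcongr
  have key : ‖S‖ ^ 4 * q * q ^ 4 ≤ G ^ 2 * C * (q.totient : ℝ) ^ 4 * q ^ 4 := by
    calc ‖S‖ ^ 4 * q * q ^ 4 ≤ (τ ^ 4 * (G * q) ^ 2) * q * (q.totient * τ) ^ 4 := by gcongr
      _ = G ^ 2 * (q.totient : ℝ) ^ 4 * q ^ 3 * τ ^ 8 := by ring
      _ ≤ G ^ 2 * (q.totient : ℝ) ^ 4 * q ^ 3 * (C * q) := by gcongr
      _ = _ := by ring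
  exact le_of_mul_le_mul_right key (by positivity)

theorem equidistribution_from_weil_bound
    (hWeil : ∀ q : ℕ, 0 < q → ∀ m n : ℤ, ¬(m = 0 ∧ n = 0) →
      ‖kloostermanS q m n‖ ≤ (q.divisors.card : ℝ) *
        Real.sqrt ((Int.gcd (Int.gcd m n) (q : ℤ) : ℝ) * q)) :
    ∀ (y : Torus2) (R : ℝ), 0 < R → R < 1 / 2 →
      Tendsto (fun q : ℕ =>
          |(muQ q (torusBall y R)).toReal - (volume (torusBall y R)).toReal|)
        atTop (nhds 0) := by
  intro y R _ _
  let μs : ℕ → ProbabilityMeasure Torus2 := fun q =>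
    ⟨muQ (q + 1), isProbabilityMeasure_muQ q.succ_pos⟩
  let μ : ProbabilityMeasure Torus2 := ⟨volume, inferInstance⟩
  have hμ : Tendsto μs atTop (nhds μ) := by
    refine tendsto_of_tendsto_integral_torusFourier fun k => ?_
    rcases eq_or_ne k 0 with rfl | hk
    · simp [torusFourier_zero]
    · change Tendsto (fun q => ∫ x, torusFourier k x ∂(muQ (q + 1))) atTop
        (nhds (∫ x, torusFourier k x))
      rw [integral_torusFourier_eq_zero hk]
      refine (tendsto_add_atTop_iff_nat
        (f := fun q => ∫ x, torusFourier k x ∂(muQ q)) 1).2 ?_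
      obtain ⟨C, hC⟩ := exists_card_divisors_pow_le 8
      have h4 : Tendsto (fun q : ℕ => ‖∫ x, torusFourier k x ∂(muQ q)‖ ^ 4) atTop (nhds 0) := by
        refine tendsto_of_tendsto_of_tendsto_of_le_of_le' tendsto_const_nhds
          (tendsto_const_div_atTop_nhds_zero_nat ((Int.gcd k.1 k.2 : ℝ) ^ 2 * C))
          (Eventually.of_forall fun q => by positivity) ?_
        filter_upwards [eventually_gt_atTop 0] with q hq
        rw [integral_torusFourier_muQ]
        exact pow_four_norm_inv_totient_mul_le hk hq (hC q hq.ne')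
          (hWeil q hq k.1 k.2 fun h => hk (Prod.ext h.1 h.2))
      rw [tendsto_zero_iff_norm_tendsto_zero]
      have h5 := h4.rpow_const (p := (4 : ℝ)⁻¹) (Or.inr (by norm_num))
      rw [Real.zero_rpow (by norm_num)] at h5
      refine h5.congr fun q => ?_
      exact Real.pow_rpow_inv_natCast (norm_nonneg _) four_ne_zero
  have hball := ProbabilityMeasure.tendsto_measure_of_null_frontier_of_tendsto' hμ
    (volume_frontier_torusBall y R)
  have hreal := (ENNReal.tendsto_toReal (measure_ne_top (μ : Measure Torus2) _)).comp hball
  rw [← tendsto_add_atTop_iff_nat 1]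
  have hdiff := (hreal.sub_const (volume (torusBall y R)).toReal).abs
  rwa [show ((μ : Measure Torus2) (torusBall y R)).toReal - (volume (torusBall y R)).toReal = 0
    from sub_self _, abs_zero] at hdiff
end

section
/- For R > 0, (m,n) ∈ ℤ² with (m,n) ≠ (0,0), and y ∈ ℝ², the Fourier coefficient ∫_{𝕋²} K_R(x,y) e(−(mx₁+nx₂)) dx equals (R·J₁(2πR√(m²+n²))/√(m²+n²))·e(−(my₁+ny₂)), where K_R(x,y) = ∑_{(m',n') ∈ ℤ²} 𝟙[|x + (m',n') − y| ≤ R]. For (m,n) = (0,0), the Fourier coefficient equals πR². -/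
open Real Complex MeasureTheory

/-- Euclidean norm on `ℝ²`. -/
noncomputable def enorm2 (v : ℝ × ℝ) : ℝ := Real.sqrt (v.1 ^ 2 + v.2 ^ 2)

/-- The Bessel function of the first kind of order 1. -/
noncomputable def besselJ1 (x : ℝ) : ℝ :=
  ∑' k : ℕ, (-1 : ℝ) ^ k / ((Nat.factorial k : ℝ) * (Nat.factorial (k + 1) : ℝ))
    * (x / 2) ^ (2 * k + 1)

/-- The periodization `K_R(x,y) = ∑_{(m',n') ∈ ℤ²} 𝟙[|x + (m',n') - y| ≤ R]`. -/
noncomputable def KR (R : ℝ) (x y : ℝ × ℝ) : ℝ :=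
  ∑' p : ℤ × ℤ, if enorm2 (x + ((p.1 : ℝ), (p.2 : ℝ)) - y) ≤ R then (1 : ℝ) else 0

theorem integral_tsum_add_intCast {f : ℝ × ℝ → ℂ} (hf : Integrable f) :
    ∫ x in Set.Ioc (0 : ℝ) 1 ×ˢ Set.Ioc (0 : ℝ) 1, ∑' p : ℤ × ℤ, f (x + ((p.1 : ℝ), (p.2 : ℝ)))
      = ∫ x, f x := by
  set S : ℤ × ℤ → Set (ℝ × ℝ) := fun p ↦
    Set.Ioc (p.1 : ℝ) (p.1 + 1) ×ˢ Set.Ioc (p.2 : ℝ) (p.2 + 1) with hS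
  have hmeas (p : ℤ × ℤ) : MeasurableSet (S p) := measurableSet_Ioc.prod measurableSet_Ioc
  have hunion : ⋃ p, S p = Set.univ := by
    refine Set.eq_univ_of_forall fun x ↦ ?_
    have h1 : x.1 ∈ ⋃ k : ℤ, Set.Ioc (k : ℝ) (k + 1) := by rw [iUnion_Ioc_intCast]; trivial
    have h2 : x.2 ∈ ⋃ k : ℤ, Set.Ioc (k : ℝ) (k + 1) := by rw [iUnion_Ioc_intCast]; trivial
    obtain ⟨a, ha⟩ := Set.mem_iUnion.1 h1
    obtain ⟨b, hb⟩ := Set.mem_iUnion.1 h2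
    exact Set.mem_iUnion.2 ⟨(a, b), ha, hb⟩
  have hdisj : Pairwise (Function.onFun Disjoint S) := by
    rintro ⟨a, b⟩ ⟨c, d⟩ h
    rw [Function.onFun, Set.disjoint_prod]
    by_cases hac : a = c
    · exact Or.inr (Set.pairwise_disjoint_Ioc_intCast ℝ fun hbd ↦ h (Prod.ext hac hbd))
    · exact Or.inl (Set.pairwise_disjoint_Ioc_intCast ℝ hac)
  have hmp (p : ℤ × ℤ) := measurePreserving_add_right (volume : Measure (ℝ × ℝ))
    ((p.1 : ℝ), (p.2 : ℝ))
  have hpre (p : ℤ × ℤ) : (fun x : ℝ × ℝ ↦ x + ((p.1 : ℝ), (p.2 : ℝ))) ⁻¹' S p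
      = Set.Ioc (0 : ℝ) 1 ×ˢ Set.Ioc (0 : ℝ) 1 := by
    ext x
    simp [hS, add_comm _ (1 : ℝ)]
  have htrans {E : Type} [NormedAddCommGroup E] [NormedSpace ℝ E] (g : ℝ × ℝ → E) (p : ℤ × ℤ) :
      ∫ x in Set.Ioc (0 : ℝ) 1 ×ˢ Set.Ioc (0 : ℝ) 1, g (x + ((p.1 : ℝ), (p.2 : ℝ)))
        = ∫ x in S p, g x := by
    rw [← hpre p]
    exact (hmp p).setIntegral_preimage_emb (measurableEmbedding_addRight _) g (S p)
  rw [← integral_tsum_of_summable_integral_norm]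
  · simp_rw [htrans]
    rw [← integral_iUnion hmeas hdisj hf.integrableOn, hunion, setIntegral_univ]
  · exact fun p ↦ ((hmp p).integrable_comp_of_integrable hf).integrableOn
  · simp_rw [htrans fun x ↦ ‖f x‖]
    exact (hasSum_integral_iUnion hmeas hdisj hf.norm.integrableOn).summable

theorem integral_cos_pow_add_two_neg_pi_pi (n : ℕ) :
    ∫ θ in (-Real.pi)..Real.pi, Real.cos θ ^ (n + 2)
      = (n + 1) / (n + 2) * ∫ θ in (-Real.pi)..Real.pi, Real.cos θ ^ n := by
  rw [integral_cos_pow]; simp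

theorem integral_cos_pow_odd_neg_pi_pi (k : ℕ) :
    ∫ θ in (-Real.pi)..Real.pi, Real.cos θ ^ (2 * k + 1) = 0 := by
  induction k with
  | zero => simp
  | succ k ih => rw [show 2 * (k + 1) + 1 = 2 * k + 1 + 2 by ring,
      integral_cos_pow_add_two_neg_pi_pi, ih, mul_zero]

theorem integral_cos_pow_even_neg_pi_pi (k : ℕ) :
    ∫ θ in (-Real.pi)..Real.pi, Real.cos θ ^ (2 * k)
      = 2 * Real.pi * (2 * k).factorial / (4 ^ k * (k.factorial : ℝ) ^ 2) := by
  induction k with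
  | zero => simp; ring
  | succ k ih =>
    rw [show 2 * (k + 1) = 2 * k + 2 by ring, integral_cos_pow_add_two_neg_pi_pi, ih]
    have := k.factorial_ne_zero
    simp only [Nat.factorial_succ, Nat.cast_mul, Nat.cast_add, Nat.cast_one, Nat.cast_ofNat]
    field_simp
    ring

theorem integral_Ioo_mul_cos_add_mul_sin_pow (a b : ℝ) (j : ℕ) :
    ∫ θ in Set.Ioo (-Real.pi) Real.pi, (a * Real.cos θ + b * Real.sin θ) ^ j
      = √(a ^ 2 + b ^ 2) ^ j * ∫ θ in (-Real.pi)..Real.pi, Real.cos θ ^ j := by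
  set z : ℂ := ⟨a, b⟩
  have hz : √(a ^ 2 + b ^ 2) = ‖z‖ := by
    rw [Complex.norm_def, Complex.normSq_mk]; ring_nf
  have ha : a = ‖z‖ * Real.cos z.arg := (Complex.norm_mul_cos_arg z).symm
  have hb : b = ‖z‖ * Real.sin z.arg := (Complex.norm_mul_sin_arg z).symm
  have hpt (θ : ℝ) : (a * Real.cos θ + b * Real.sin θ) ^ j
      = ‖z‖ ^ j * Real.cos (θ - z.arg) ^ j := by
    rw [← mul_pow, Real.cos_sub]
    congr 1
    linear_combination Real.cos θ * ha + Real.sin θ * hb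
  have hper : Function.Periodic (fun θ ↦ Real.cos θ ^ j) (2 * Real.pi) := fun θ ↦ by simp
  rw [← integral_Ioc_eq_integral_Ioo, ← intervalIntegral.integral_of_le (by linarith [Real.pi_pos]), hz]
  simp_rw [hpt]
  rw [intervalIntegral.integral_const_mul,
    intervalIntegral.integral_comp_sub_right (fun θ ↦ Real.cos θ ^ j)]
  have := hper.intervalIntegral_add_eq (-Real.pi - z.arg) (-Real.pi)
  ring_nf at this ⊢
  rw [this]

theorem integral_ball_eq_integral_polar (R a b : ℝ) :
    ∫ u : ℝ × ℝ, (if enorm2 u ≤ R then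
        Complex.exp (-(2 * Real.pi * Complex.I * (a * u.1 + b * u.2))) else 0)
      = ∫ p in Set.Ioc 0 R ×ˢ Set.Ioo (-Real.pi) Real.pi, (p.1 : ℂ) *
        Complex.exp (-(2 * Real.pi * Complex.I) *
          (p.1 * ((a * Real.cos p.2 + b * Real.sin p.2 : ℝ) : ℂ))) := by
  have hmeas : MeasurableSet (Set.Ioc 0 R ×ˢ Set.Ioo (-Real.pi) Real.pi) :=
    measurableSet_Ioc.prod measurableSet_Ioo
  have hsub : Set.Ioc 0 R ×ˢ Set.Ioo (-Real.pi) Real.pi ⊆ polarCoord.target :=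
    Set.prod_mono (fun x hx ↦ hx.1) subset_rfl
  rw [← integral_comp_polarCoord_symm]
  conv_rhs => rw [← Set.inter_eq_right.2 hsub, ← setIntegral_indicator hmeas]
  refine setIntegral_congr_fun polarCoord.open_target.measurableSet fun p hp ↦ ?_
  rw [polarCoord_target] at hp
  have hp1 : 0 < p.1 := hp.1
  have hnorm : enorm2 (polarCoord.symm p) = p.1 := by
    rw [polarCoord_symm_apply, enorm2, ← Real.sqrt_sq hp1.le]
    congr 1
    rw [Real.sqrt_sq hp1.le]
    linear_combination p.1 ^ 2 * Real.cos_sq_add_sin_sq p.2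
  by_cases h : p.1 ≤ R
  · have hmem : p ∈ Set.Ioc 0 R ×ˢ Set.Ioo (-Real.pi) Real.pi := ⟨⟨hp1, h⟩, hp.2⟩
    simp only [hnorm, if_pos h, Set.indicator_of_mem hmem, real_smul]
    rw [polarCoord_symm_apply]
    congr 2
    push_cast
    ring
  · have hmem : p ∉ Set.Ioc 0 R ×ˢ Set.Ioo (-Real.pi) Real.pi := fun hmem ↦ h hmem.1.2
    simp only [hnorm, if_neg h, Set.indicator_of_notMem hmem, smul_zero]

theorem integral_polar_monomial {R : ℝ} (hR : 0 ≤ R) (a b : ℝ) (j : ℕ) :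
    ∫ p in Set.Ioc 0 R ×ˢ Set.Ioo (-Real.pi) Real.pi,
        p.1 ^ (j + 1) * (a * Real.cos p.2 + b * Real.sin p.2) ^ j
      = R ^ (j + 2) / (j + 2) *
        (√(a ^ 2 + b ^ 2) ^ j * ∫ θ in (-Real.pi)..Real.pi, Real.cos θ ^ j) := by
  rw [Measure.volume_eq_prod, setIntegral_prod_mul (fun r : ℝ ↦ r ^ (j + 1))
    (fun θ ↦ (a * Real.cos θ + b * Real.sin θ) ^ j), integral_Ioo_mul_cos_add_mul_sin_pow,
    ← intervalIntegral.integral_of_le hR, integral_pow]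
  congr 1
  simp
  ring

theorem hasSum_integral_polar {R : ℝ} (hR : 0 ≤ R) (a b : ℝ) (c : ℂ) :
    HasSum (fun j : ℕ ↦ c ^ j / (j.factorial : ℂ) *
        ((∫ p in Set.Ioc 0 R ×ˢ Set.Ioo (-Real.pi) Real.pi,
          p.1 ^ (j + 1) * (a * Real.cos p.2 + b * Real.sin p.2) ^ j : ℝ) : ℂ))
      (∫ p in Set.Ioc 0 R ×ˢ Set.Ioo (-Real.pi) Real.pi, (p.1 : ℂ) *
        Complex.exp (c * (p.1 * ((a * Real.cos p.2 + b * Real.sin p.2 : ℝ) : ℂ)))) := by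
  set S := Set.Ioc 0 R ×ˢ Set.Ioo (-Real.pi) Real.pi with hS
  have hmeas : MeasurableSet S := measurableSet_Ioc.prod measurableSet_Ioo
  set M := ‖c‖ * (R * (|a| + |b|)) with hM
  have hfin : volume S < ⊤ := by
    rw [hS, Measure.volume_eq_prod, Measure.prod_prod, Real.volume_Ioc, Real.volume_Ioo]
    exact ENNReal.mul_lt_top ENNReal.ofReal_lt_top ENNReal.ofReal_lt_top
  have hsum : Summable fun j : ℕ ↦ R * (M ^ j / j.factorial) :=
    (Real.summable_pow_div_factorial M).mul_left R
  have key := hasSum_integral_of_dominated_convergence (μ := volume.restrict S)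
    (F := fun (j : ℕ) (p : ℝ × ℝ) ↦ c ^ j / (j.factorial : ℂ) *
      ((p.1 ^ (j + 1) * (a * Real.cos p.2 + b * Real.sin p.2) ^ j : ℝ) : ℂ))
    (f := fun p ↦ (p.1 : ℂ) *
        Complex.exp (c * (p.1 * ((a * Real.cos p.2 + b * Real.sin p.2 : ℝ) : ℂ))))
    (fun j _ ↦ R * (M ^ j / j.factorial)) ?_ ?_ ?_ ?_ ?_
  · refine key.congr_fun fun j ↦ ?_
    rw [integral_const_mul, integral_complex_ofReal]
  · exact fun j ↦ Continuous.aestronglyMeasurable (by fun_prop)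
  · refine fun j ↦ (ae_restrict_iff' hmeas).2 (.of_forall fun p hp ↦ ?_)
    have h0 : 0 ≤ p.1 := hp.1.1.le
    have htrig : |a * Real.cos p.2 + b * Real.sin p.2| ≤ |a| + |b| := by
      refine (abs_add_le _ _).trans (add_le_add ?_ ?_) <;> rw [abs_mul]
      · exact mul_le_of_le_one_right (abs_nonneg _) (Real.abs_cos_le_one _)
      · exact mul_le_of_le_one_right (abs_nonneg _) (Real.abs_sin_le_one _)
    rw [norm_mul, norm_div, norm_pow, Complex.norm_natCast, Complex.norm_real, Real.norm_eq_abs,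
      abs_mul, abs_pow, abs_pow, abs_of_nonneg h0]
    calc ‖c‖ ^ j / j.factorial * (p.1 ^ (j + 1) * |a * Real.cos p.2 + b * Real.sin p.2| ^ j)
        ≤ ‖c‖ ^ j / j.factorial * (R ^ (j + 1) * (|a| + |b|) ^ j) := by
          gcongr
          exact hp.1.2
      _ = R * (M ^ j / j.factorial) := by rw [hM, mul_pow, mul_pow]; ring
  · exact .of_forall fun _ ↦ hsum
  · exact integrable_const_iff.2 (Or.inr ⟨by simpa using hfin⟩)
  · refine .of_forall fun p ↦ ?_
    rw [Complex.exp_eq_exp_ℂ]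
    have := (NormedSpace.expSeries_div_hasSum_exp (c * ((p.1 : ℂ) *
      ((a * Real.cos p.2 + b * Real.sin p.2 : ℝ) : ℂ)))).mul_left (p.1 : ℂ)
    refine this.congr_fun fun j ↦ ?_
    rw [mul_pow c, mul_pow (p.1 : ℂ)]
    push_cast
    ring

theorem hasSum_integral_ball {R : ℝ} (hR : 0 ≤ R) (a b : ℝ) :
    HasSum (fun k : ℕ ↦ (((-1) ^ k * Real.pi ^ (2 * k + 1) * √(a ^ 2 + b ^ 2) ^ (2 * k)
        * R ^ (2 * k + 2) / (k.factorial * (k + 1).factorial) : ℝ) : ℂ))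
      (∫ u : ℝ × ℝ, if enorm2 u ≤ R then
        Complex.exp (-(2 * Real.pi * Complex.I * (a * u.1 + b * u.2))) else 0) := by
  rw [integral_ball_eq_integral_polar]
  have key := hasSum_integral_polar hR a b (-(2 * Real.pi * Complex.I))
  simp_rw [integral_polar_monomial hR] at key
  rw [← (mul_right_injective₀ (two_ne_zero' ℕ)).hasSum_iff] at key
  · convert key using 2 with k
    have hk := k.factorial_ne_zero
    have h2k := (2 * k).factorial_ne_zero
    have hI : (-(2 * Real.pi * Complex.I)) ^ (2 * k)
        = (((-1) ^ k * 4 ^ k * Real.pi ^ (2 * k) : ℝ) : ℂ) := by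
      rw [pow_mul, neg_sq, mul_pow, Complex.I_sq]
      push_cast
      rw [pow_mul, ← mul_pow, ← mul_pow]
      congr 1
      ring
    simp only [Function.comp_apply]
    rw [hI, integral_cos_pow_even_neg_pi_pi, ← Complex.ofReal_natCast, ← Complex.ofReal_div,
      ← Complex.ofReal_mul, Nat.factorial_succ]
    congr 1
    push_cast
    field_simp
    ring
  · intro j hj
    rcases Nat.even_or_odd' j with ⟨k, rfl | rfl⟩
    · exact absurd ⟨k, rfl⟩ hj
    · rw [integral_cos_pow_odd_neg_pi_pi]; simp

theorem integral_ball_eq_besselJ1 {R : ℝ} (hR : 0 ≤ R) {a b : ℝ} (hab : a ^ 2 + b ^ 2 ≠ 0) :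
    ∫ u : ℝ × ℝ, (if enorm2 u ≤ R then
        Complex.exp (-(2 * Real.pi * Complex.I * (a * u.1 + b * u.2))) else 0)
      = ((R * besselJ1 (2 * Real.pi * R * √(a ^ 2 + b ^ 2)) / √(a ^ 2 + b ^ 2) : ℝ) : ℂ) := by
  have hρ : √(a ^ 2 + b ^ 2) ≠ 0 := by
    rw [Real.sqrt_ne_zero (by positivity)]; exact hab
  rw [← (hasSum_integral_ball hR a b).tsum_eq, ← Complex.ofReal_tsum, besselJ1, mul_div_right_comm,
    ← tsum_mul_left]
  congr 2
  ext k
  field_simp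
  ring

theorem integral_ball_eq_area {R : ℝ} (hR : 0 ≤ R) :
    ∫ u : ℝ × ℝ, (if enorm2 u ≤ R then
        Complex.exp (-(2 * Real.pi * Complex.I * ((0 : ℝ) * u.1 + (0 : ℝ) * u.2))) else 0)
      = ((Real.pi * R ^ 2 : ℝ) : ℂ) := by
  rw [← (hasSum_integral_ball hR 0 0).tsum_eq, tsum_eq_single 0]
  · simp
  · intro k hk
    simp [hk]

theorem measurable_enorm2 : Measurable enorm2 := by
  unfold enorm2
  fun_prop

theorem integrable_ball_character (R : ℝ) (y : ℝ × ℝ) (a b : ℝ) :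
    Integrable fun z : ℝ × ℝ ↦ if enorm2 (z - y) ≤ R then
      Complex.exp (-(2 * Real.pi * Complex.I * (a * z.1 + b * z.2))) else 0 := by
  have hmeas : MeasurableSet {z : ℝ × ℝ | enorm2 (z - y) ≤ R} :=
    measurableSet_le (measurable_enorm2.comp (measurable_id.sub_const y)) measurable_const
  have hsub : {z : ℝ × ℝ | enorm2 (z - y) ≤ R} ⊆ Metric.closedBall y R := by
    intro z hz
    rw [Metric.mem_closedBall, dist_eq_norm, Prod.norm_def]
    refine le_trans (max_le ?_ ?_) hz <;> apply Real.abs_le_sqrt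
    · linarith [sq_nonneg (z - y).2]
    · linarith [sq_nonneg (z - y).1]
  have hcont : Continuous fun z : ℝ × ℝ ↦
      Complex.exp (-(2 * Real.pi * Complex.I * (a * z.1 + b * z.2))) := by fun_prop
  exact (integrable_indicator_iff hmeas).2
    ((hcont.continuousOn.integrableOn_compact (isCompact_closedBall y R)).mono_set hsub)

theorem fourier_coefficient_of_periodized_ball (R : ℝ) (hR : 0 < R)
    (m n : ℤ) (y : ℝ × ℝ) :
    ∫ x in (Set.Ioc (0 : ℝ) 1 ×ˢ Set.Ioc (0 : ℝ) 1),
        (KR R x y : ℂ) * Complex.exp (-(2 * Real.pi * Complex.I * (m * x.1 + n * x.2)))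
      = if m = 0 ∧ n = 0 then ((Real.pi * R ^ 2 : ℝ) : ℂ)
        else ((R * besselJ1 (2 * Real.pi * R * Real.sqrt ((m : ℝ) ^ 2 + (n : ℝ) ^ 2))
                / Real.sqrt ((m : ℝ) ^ 2 + (n : ℝ) ^ 2) : ℝ) : ℂ)
              * Complex.exp (-(2 * Real.pi * Complex.I * (m * y.1 + n * y.2))) := by
  set f : ℝ × ℝ → ℂ := fun z ↦ if enorm2 (z - y) ≤ R then
    Complex.exp (-(2 * Real.pi * Complex.I * ((m : ℝ) * z.1 + (n : ℝ) * z.2))) else 0 with hf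
  have hperiod (x : ℝ × ℝ) :
      (KR R x y : ℂ) * Complex.exp (-(2 * Real.pi * Complex.I * (m * x.1 + n * x.2)))
        = ∑' p : ℤ × ℤ, f (x + ((p.1 : ℝ), (p.2 : ℝ))) := by
    rw [KR, Complex.ofReal_tsum, ← tsum_mul_right]
    refine tsum_congr fun p ↦ ?_
    simp only [hf]
    split_ifs
    · rw [Complex.ofReal_one, one_mul, Complex.exp_eq_exp_iff_exists_int]
      refine ⟨m * p.1 + n * p.2, ?_⟩
      push_cast [Prod.fst_add, Prod.snd_add]
      ring
    · simp
  have hshift : ∫ z, f z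
      = (∫ u : ℝ × ℝ, if enorm2 u ≤ R then
          Complex.exp (-(2 * Real.pi * Complex.I * ((m : ℝ) * u.1 + (n : ℝ) * u.2))) else 0)
        * Complex.exp (-(2 * Real.pi * Complex.I * (m * y.1 + n * y.2))) := by
    rw [← integral_mul_const, ← integral_add_right_eq_self f y]
    refine integral_congr_ae (.of_forall fun u ↦ ?_)
    simp only [hf, add_sub_cancel_right]
    split_ifs
    · rw [← Complex.exp_add]
      congr 1
      push_cast [Prod.fst_add, Prod.snd_add]
      ring
    · simp
  simp_rw [hperiod]
  rw [integral_tsum_add_intCast (integrable_ball_character R y m n), hshift]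
  split_ifs with h
  · obtain ⟨rfl, rfl⟩ := h
    rw [Int.cast_zero, integral_ball_eq_area hR.le]
    simp
  · rw [integral_ball_eq_besselJ1 hR.le]
    intro h0
    have h1 : (m : ℝ) ^ 2 = 0 := by nlinarith [sq_nonneg (m : ℝ), sq_nonneg (n : ℝ)]
    have h2 : (n : ℝ) ^ 2 = 0 := by nlinarith [sq_nonneg (m : ℝ), sq_nonneg (n : ℝ)]
    exact h (by simpa using And.intro h1 h2)
end

section
/- Define Var(μ_q; B_R) := ∫_{𝕋²} (μ_q(B_R(x)) − vol(B_R))² dx, where μ_q is the uniform probability measure on {(d/q, d⁻¹/q) : d ∈ (ℤ/qℤ)ˣ} and B_R(x) is the ball of radius R < 1/2 centered at x. Then Var(μ_q; B_R) = (R²/φ(q)²)·∑_{(m,n) ≠ (0,0)} J₁(2πR√(m²+n²))²/(m²+n²)·S(m,n;q)², where S(m,n;q) is the Kloosterman sum. -/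
open Real Complex MeasureTheory

/-- `μ_q(B_R(x))`, the proportion of the points `(d/q, d⁻¹/q)` lying in `B_R(x)`. -/
noncomputable def muVal (q : ℕ) (R : ℝ) (x : ℝ × ℝ) : ℝ :=
  (1 / (q.totient : ℝ)) *
    ∑ d ∈ (Finset.range q).filter (fun d => Nat.Coprime d q),
      KR R ((d : ℝ) / q, ((((d : ZMod q)⁻¹).val : ℕ) : ℝ) / q) x

/-- The variance `Var(μ_q; B_R) = ∫_{𝕋²} (μ_q(B_R(x)) - vol(B_R))² dx`. -/
noncomputable def varMu (q : ℕ) (R : ℝ) : ℝ :=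
  ∫ x in (Set.Ioc (0 : ℝ) 1 ×ˢ Set.Ioc (0 : ℝ) 1),
    (muVal q R x - Real.pi * R ^ 2) ^ 2

theorem integral_cos_pow_symm_pi (j : ℕ) :
    ∫ θ in (-π)..π, Real.cos θ ^ (2 * j) =
      2 * π * ((2 * j).factorial / (4 ^ j * (j.factorial : ℝ) ^ 2)) := by
  induction j with
  | zero => simp; ring
  | succ j ih =>
    rw [show 2 * (j + 1) = 2 * j + 2 by ring, integral_cos_pow, ih]
    simp only [Nat.factorial_succ, pow_succ]
    push_cast
    simp
    field_simp
    ring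

theorem integral_cos_pow_odd_symm_pi (j : ℕ) :
    ∫ θ in (-π)..π, Real.cos θ ^ (2 * j + 1) = 0 := by
  induction j with
  | zero => simp
  | succ j ih =>
    rw [show 2 * (j + 1) + 1 = (2 * j + 1) + 2 by ring, integral_cos_pow, ih]
    simp

theorem hasSum_integral_exp_mul_cos (z : ℝ) :
    HasSum (fun j : ℕ => 2 * (π : ℂ) * ((-1) ^ j * (z / 2) ^ (2 * j) / (j.factorial : ℂ) ^ 2))
      (∫ θ in (-π)..π, cexp (I * (z * Real.cos θ))) := by
  have h : HasSum (fun j : ℕ => ∫ θ in (-π)..π, (I * (z * Real.cos θ)) ^ j / (j.factorial : ℂ))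
      (∫ θ in (-π)..π, cexp (I * (z * Real.cos θ))) := by
    apply intervalIntegral.hasSum_integral_of_dominated_convergence
      (fun j _ => |z| ^ j / (j.factorial : ℝ))
    · intro n
      exact Continuous.aestronglyMeasurable (by fun_prop)
    · intro n
      refine .of_forall fun θ _ => ?_
      rw [norm_div, norm_pow, norm_mul, norm_mul]
      simp only [norm_I, one_mul, norm_real, Real.norm_eq_abs, Complex.norm_natCast]
      gcongr
      exact mul_le_of_le_one_right (abs_nonneg _) (Real.abs_cos_le_one θ)
    · exact .of_forall fun θ _ => Real.summable_pow_div_factorial _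
    · exact intervalIntegrable_const
    · exact .of_forall fun θ _ => Complex.exp_eq_exp_ℂ ▸ NormedSpace.expSeries_div_hasSum_exp _
  have hterm (j : ℕ) : ∫ θ in (-π)..π, (I * (z * Real.cos θ)) ^ j / (j.factorial : ℂ) =
      (I * z) ^ j / (j.factorial : ℂ) * ((∫ θ in (-π)..π, Real.cos θ ^ j : ℝ) : ℂ) := by
    rw [← intervalIntegral.integral_ofReal, ← intervalIntegral.integral_const_mul]
    congr 1 with θ
    push_cast
    ring
  simp only [hterm] at h
  have hinj : Function.Injective (fun j : ℕ => 2 * j) := fun a b h => by simpa using h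
  rw [← hinj.hasSum_iff] at h
  · convert! h using 2 with j
    simp only [Function.comp, integral_cos_pow_symm_pi, mul_pow, pow_mul I, I_sq]
    push_cast
    have := Nat.cast_ne_zero (R := ℂ).2 (Nat.factorial_ne_zero (2 * j))
    have := Nat.cast_ne_zero (R := ℂ).2 (Nat.factorial_ne_zero j)
    field_simp
    rw [div_pow, pow_mul 2]
    norm_num
  · intro j hj
    obtain ⟨k, rfl | rfl⟩ := Nat.even_or_odd' j
    · exact absurd ⟨k, rfl⟩ hj
    · simp [integral_cos_pow_odd_symm_pi]

theorem integral_exp_mul_cos_add_sin (a b r : ℝ) :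
    ∫ θ in (-π)..π, cexp (I * (a * (r * Real.cos θ) + b * (r * Real.sin θ))) =
      ∫ θ in (-π)..π, cexp (I * ((r * √(a ^ 2 + b ^ 2) : ℝ) * Real.cos θ)) := by
  set w : ℂ := ⟨a, b⟩
  have hw : √(a ^ 2 + b ^ 2) = ‖w‖ := by
    rw [Complex.norm_def, Complex.normSq_apply, sq, sq]
  set g : ℝ → ℂ := fun θ => cexp (I * ((r * √(a ^ 2 + b ^ 2) : ℝ) * Real.cos θ))
  have hg : Function.Periodic g (2 * π) := fun θ => by
    simp only [g, Real.cos_add_two_pi]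
  have h1 (θ : ℝ) : cexp (I * (a * (r * Real.cos θ) + b * (r * Real.sin θ))) = g (θ - arg w) := by
    have ha : a = ‖w‖ * Real.cos (arg w) := (Complex.norm_mul_cos_arg w).symm
    have hb : b = ‖w‖ * Real.sin (arg w) := (Complex.norm_mul_sin_arg w).symm
    simp only [g]
    rw [hw, Real.cos_sub]
    conv_lhs => rw [ha, hb]
    push_cast
    ring_nf
  simp only [h1]
  rw [intervalIntegral.integral_comp_sub_right]
  have := hg.intervalIntegral_add_eq (-π - arg w) (-π)
  convert this using 2 <;> ring

theorem integral_disk_exp {R : ℝ} (hR : 0 ≤ R) (a b : ℝ) :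
    ∫ y in {y : ℝ × ℝ | enorm2 y ≤ R}, cexp (I * (a * y.1 + b * y.2)) =
      ((∑' j : ℕ, (-1) ^ j * π / (j.factorial * (j + 1).factorial) *
        (√(a ^ 2 + b ^ 2) / 2) ^ (2 * j) * R ^ (2 * j + 2) : ℝ) : ℂ) := by
  have hm : MeasurableSet {y : ℝ × ℝ | enorm2 y ≤ R} := by
    unfold enorm2; exact measurableSet_le (by fun_prop) (by fun_prop)
  set s := √(a ^ 2 + b ^ 2) with hs
  have hJ : ∫ y in {y : ℝ × ℝ | enorm2 y ≤ R}, cexp (I * (a * y.1 + b * y.2)) =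
      ∫ r in (0)..R, (r : ℂ) * ∫ θ in (-π)..π, cexp (I * ((r * s : ℝ) * Real.cos θ)) := by
    rw [← integral_indicator hm, ← integral_comp_polarCoord_symm, polarCoord_target]
    have h1 : ∫ p in Set.Ioi (0 : ℝ) ×ˢ Set.Ioo (-π) π, p.1 • ({y : ℝ × ℝ | enorm2 y ≤ R}.indicator
          (fun y : ℝ × ℝ => cexp (I * (a * y.1 + b * y.2)))) (polarCoord.symm p) =
        ∫ p in Set.Ioc 0 R ×ˢ Set.Ioo (-π) π,
          (p.1 : ℂ) * cexp (I * (a * (p.1 * Real.cos p.2) + b * (p.1 * Real.sin p.2))) := by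
      rw [← integral_indicator (measurableSet_Ioi.prod measurableSet_Ioo),
        ← integral_indicator (measurableSet_Ioc.prod measurableSet_Ioo)]
      congr 1 with p
      have he : 0 < p.1 → enorm2 (p.1 * Real.cos p.2, p.1 * Real.sin p.2) = p.1 := by
        intro hp
        simp only [enorm2, mul_pow, ← mul_add, Real.cos_sq_add_sin_sq, mul_one]
        exact Real.sqrt_sq hp.le
      simp only [Set.indicator, Set.mem_prod, polarCoord_symm_apply, Set.mem_Ioi, Set.mem_Ioc,
        Set.mem_ofPred_eq, real_smul]
      by_cases h0 : 0 < p.1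
      · rw [he h0]
        by_cases h2 : p.2 ∈ Set.Ioo (-π) π <;> by_cases h3 : p.1 ≤ R <;> simp [h0, h2, h3]
      · simp [h0]
    rw [h1, Measure.volume_eq_prod, setIntegral_prod]
    · rw [intervalIntegral.integral_of_le hR]
      congr 1 with r
      rw [← integral_exp_mul_cos_add_sin, intervalIntegral.integral_of_le (by linarith [pi_pos]),
        integral_Ioc_eq_integral_Ioo, ← integral_const_mul]
    · refine (Continuous.continuousOn (by fun_prop)).integrableOn_compact
        (isCompact_Icc.prod isCompact_Icc) |>.mono_set
          (Set.prod_mono Set.Ioc_subset_Icc_self Set.Ioo_subset_Icc_self)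
  have h : HasSum (fun j : ℕ => ∫ r in (0)..R, (r : ℂ) * (2 * (π : ℂ) *
        ((-1) ^ j * ((r * s : ℝ) / 2) ^ (2 * j) / (j.factorial : ℂ) ^ 2)))
      (∫ r in (0)..R, (r : ℂ) * ∫ θ in (-π)..π, cexp (I * ((r * s : ℝ) * Real.cos θ))) := by
    apply intervalIntegral.hasSum_integral_of_dominated_convergence
      (fun j _ => R * (2 * π * (((R * s / 2) ^ 2) ^ j / (j.factorial : ℝ))))
    · intro n
      exact Continuous.aestronglyMeasurable (by fun_prop)
    · intro n
      refine .of_forall fun r hr => ?_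
      rw [Set.uIoc_of_le hR] at hr
      have h0 := hr.1.le
      have h1 := hr.2
      have hs0 : 0 ≤ s := Real.sqrt_nonneg _
      have hf : (1 : ℝ) ≤ n.factorial := by exact_mod_cast Nat.factorial_pos n
      simp only [norm_mul, norm_div, norm_pow, norm_real, Real.norm_eq_abs, norm_neg, norm_one,
        one_pow, one_mul, Complex.norm_natCast, Complex.norm_ofNat, abs_of_nonneg h0,
        abs_of_nonneg hs0, abs_of_pos pi_pos, pow_mul]
      gcongr
      exact le_self_pow₀ hf two_ne_zero
    · exact .of_forall fun θ _ =>
        ((Real.summable_pow_div_factorial _).mul_left _).mul_left _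
    · exact intervalIntegrable_const
    · exact .of_forall fun r _ => (hasSum_integral_exp_mul_cos _).mul_left _
  rw [hJ, ← h.tsum_eq, ofReal_tsum]
  congr 1 with j
  have hterm : ∫ r in (0)..R, (r : ℂ) * (2 * (π : ℂ) *
        ((-1) ^ j * ((r * s : ℝ) / 2) ^ (2 * j) / (j.factorial : ℂ) ^ 2)) =
      ((2 * π * (-1) ^ j * (s / 2) ^ (2 * j) / (j.factorial : ℝ) ^ 2 *
        ∫ r in (0)..R, r ^ (2 * j + 1) : ℝ) : ℂ) := by
    rw [← intervalIntegral.integral_const_mul, ← intervalIntegral.integral_ofReal]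
    congr 1 with r
    push_cast
    ring
  rw [hterm, integral_pow, Nat.factorial_succ]
  congr 1
  push_cast
  field_simp
  ring

attribute [local instance] instMeasureSpaceUnitAddCircle
attribute [local instance] instIsProbabilityMeasureUnitAddCircleVolume

theorem integral_torus_comp_equivIoc {E : Type*} [NormedAddCommGroup E] [NormedSpace ℝ E]
    (H : ℝ × ℝ → E) :
    ∫ t : UnitAddTorus (Fin 2),
      H ((AddCircle.equivIoc 1 0 (t 0) : ℝ), (AddCircle.equivIoc 1 0 (t 1) : ℝ)) =
    ∫ x in Set.Ioc (0 : ℝ) 1 ×ˢ Set.Ioc (0 : ℝ) 1, H x := by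
  rw [UnitAddTorus.integral_preimage _ (fun _ => 0),
    ← (volume_preserving_finTwoArrow ℝ).setIntegral_preimage_emb
      MeasurableEquiv.finTwoArrow.measurableEmbedding]
  have hset : MeasurableEquiv.finTwoArrow ⁻¹' (Set.Ioc (0 : ℝ) 1 ×ˢ Set.Ioc (0 : ℝ) 1) =
      {x : Fin 2 → ℝ | ∀ i, x i ∈ Set.Ioc (0 : ℝ) (0 + 1)} := by
    ext x
    simp [MeasurableEquiv.finTwoArrow, Fin.forall_fin_two]
  rw [hset]
  refine setIntegral_congr_fun ?_ fun x hx => ?_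
  · rw [← hset]
    exact MeasurableEquiv.finTwoArrow.measurable (measurableSet_Ioc.prod measurableSet_Ioc)
  · have h0 (i : Fin 2) : (AddCircle.equivIoc 1 0 (x i : AddCircle (1 : ℝ)) : ℝ) = x i :=
      congrArg Subtype.val ((AddCircle.equivIoc 1 0).apply_symm_apply ⟨x i, hx i⟩)
    simp only [h0]
    rfl

theorem hasSum_sq_norm_integral_unit_square {G : ℝ × ℝ → ℂ} (hG : Measurable G) {C : ℝ}
    (hC : ∀ x, ‖G x‖ ≤ C) :
    HasSum (fun p : ℤ × ℤ => ‖∫ x in Set.Ioc (0 : ℝ) 1 ×ˢ Set.Ioc (0 : ℝ) 1,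
        cexp (-(2 * π * I * (p.1 * x.1 + p.2 * x.2))) * G x‖ ^ 2)
      (∫ x in Set.Ioc (0 : ℝ) 1 ×ˢ Set.Ioc (0 : ℝ) 1, ‖G x‖ ^ 2) := by
  set f : UnitAddTorus (Fin 2) → ℂ := fun t =>
    G ((AddCircle.equivIoc 1 0 (t 0) : ℝ), (AddCircle.equivIoc 1 0 (t 1) : ℝ))
  have hrep : Measurable fun s : UnitAddCircle => (AddCircle.equivIoc 1 0 s : ℝ) :=
    measurable_subtype_coe.comp (AddCircle.measurableEquivIoc 1 0).measurable
  have hf : Measurable f :=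
    hG.comp ((hrep.comp (measurable_pi_apply 0)).prodMk (hrep.comp (measurable_pi_apply 1)))
  have hL : MemLp f 2 (volume : Measure (UnitAddTorus (Fin 2))) :=
    MemLp.of_bound hf.aestronglyMeasurable C (.of_forall fun t => hC _)
  have h := UnitAddTorus.hasSum_sq_mFourierCoeff (hL.toLp f)
  have hintegral : ∫ t, ‖(hL.toLp f) t‖ ^ 2 =
      ∫ x in Set.Ioc (0 : ℝ) 1 ×ˢ Set.Ioc (0 : ℝ) 1, ‖G x‖ ^ 2 := by
    rw [← integral_torus_comp_equivIoc]
    refine integral_congr_ae ?_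
    filter_upwards [hL.coeFn_toLp] with t ht
    rw [ht]
  rw [hintegral, ← (finTwoArrowEquiv ℤ).symm.hasSum_iff] at h
  refine h.congr_fun ?_
  intro p
  simp only [Function.comp]
  congr 2
  rw [← integral_torus_comp_equivIoc, UnitAddTorus.mFourierCoeff]
  refine integral_congr_ae ?_
  filter_upwards [hL.coeFn_toLp] with t ht
  rw [ht, smul_eq_mul]
  congr 1
  have hcoe (i : Fin 2) : ((AddCircle.equivIoc 1 0 (t i) : ℝ) : UnitAddCircle) = t i :=
    (AddCircle.equivIoc 1 0).symm_apply_apply (t i)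
  rw [UnitAddTorus.mFourier, ContinuousMap.coe_mk, Fin.prod_univ_two, ← hcoe 0, ← hcoe 1,
    fourier_coe_apply, fourier_coe_apply, ← Complex.exp_add]
  simp only [hcoe]
  congr 1
  simp [finTwoArrowEquiv]
  ring

theorem measurableSet_enorm2_sub_le (R : ℝ) (c : ℝ × ℝ) :
    MeasurableSet {x : ℝ × ℝ | enorm2 (c - x) ≤ R} := by
  unfold enorm2
  exact measurableSet_le (by fun_prop) (by fun_prop)

theorem intCast_eq_of_enorm2_le {R : ℝ} (hR : R < 1 / 2) {y : ℝ × ℝ} {p p' : ℤ × ℤ}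
    (h : enorm2 (y + ((p.1 : ℝ), (p.2 : ℝ))) ≤ R) (h' : enorm2 (y + ((p'.1 : ℝ), (p'.2 : ℝ))) ≤ R) :
    p = p' := by
  have key {u v : ℝ} (h : enorm2 (u, v) ≤ R) : |u| < 1 / 2 ∧ |v| < 1 / 2 := by
    have h1 : |u| ≤ enorm2 (u, v) := Real.abs_le_sqrt (by simp; positivity)
    have h2 : |v| ≤ enorm2 (u, v) := Real.abs_le_sqrt (by simp; positivity)
    constructor <;> linarith
  have hcast {u : ℝ} {m n : ℤ} (h : |u + m| < 1 / 2) (h' : |u + n| < 1 / 2) : m = n := by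
    rw [abs_lt] at h h'
    have h1 : (m : ℝ) < n + 1 := by linarith
    have h2 : (n : ℝ) < m + 1 := by linarith
    norm_cast at h1 h2
    omega
  obtain ⟨h1, h2⟩ := key (u := y.1 + p.1) (v := y.2 + p.2) h
  obtain ⟨h1', h2'⟩ := key (u := y.1 + p'.1) (v := y.2 + p'.2) h'
  exact Prod.ext (hcast h1 h1') (hcast h2 h2')

theorem pairwise_disjoint_translates {R : ℝ} (hR : R < 1 / 2) (c : ℝ × ℝ) :
    Pairwise (Function.onFun Disjoint fun p : ℤ × ℤ =>
      {x : ℝ × ℝ | enorm2 (c + ((p.1 : ℝ), (p.2 : ℝ)) - x) ≤ R}) := by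
  intro p p' hne
  refine Set.disjoint_left.2 fun x hx hx' => hne ?_
  refine intCast_eq_of_enorm2_le hR (y := c - x) ?_ ?_
  · simpa [sub_add_eq_add_sub] using hx
  · simpa [sub_add_eq_add_sub] using hx'

theorem KR_eq_indicator {R : ℝ} (hR : R < 1 / 2) (c x : ℝ × ℝ) :
    KR R c x = (⋃ p : ℤ × ℤ, {x : ℝ × ℝ | enorm2 (c + ((p.1 : ℝ), (p.2 : ℝ)) - x) ≤ R}).indicator
      1 x := by
  by_cases h : ∃ p : ℤ × ℤ, enorm2 (c + ((p.1 : ℝ), (p.2 : ℝ)) - x) ≤ R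
  · obtain ⟨p, hp⟩ := h
    rw [Set.indicator_of_mem (Set.mem_iUnion.2 ⟨p, hp⟩), KR, tsum_eq_single p, if_pos hp]
    · rfl
    · intro p' hp'
      rw [if_neg]
      exact fun h => Set.disjoint_left.1 (pairwise_disjoint_translates hR c hp') h hp
  · rw [Set.indicator_of_notMem (by simpa using h), KR]
    push Not at h
    simp [fun p => (h p).not_ge]

theorem measurable_KR {R : ℝ} (hR : R < 1 / 2) (c : ℝ × ℝ) : Measurable (KR R c) := by
  rw [funext (KR_eq_indicator hR c)]
  exact measurable_one.indicator (.iUnion fun p => measurableSet_enorm2_sub_le _ _)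

theorem norm_KR_le_one {R : ℝ} (hR : R < 1 / 2) (c x : ℝ × ℝ) : ‖KR R c x‖ ≤ 1 := by
  rw [KR_eq_indicator hR]
  exact (norm_indicator_le_norm_self _ _).trans (by simp)

theorem exp_neg_add_int (p k : ℤ × ℤ) (x : ℝ × ℝ) :
    cexp (-(2 * π * I * (p.1 * (x + ((k.1 : ℝ), (k.2 : ℝ))).1 +
      p.2 * (x + ((k.1 : ℝ), (k.2 : ℝ))).2))) =
    cexp (-(2 * π * I * (p.1 * x.1 + p.2 * x.2))) := by
  rw [Complex.exp_eq_exp_iff_exists_int]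
  refine ⟨-(p.1 * k.1 + p.2 * k.2), ?_⟩
  push_cast [Prod.fst_add, Prod.snd_add]
  ring

theorem integral_unit_square_KR {R : ℝ} (hR : R < 1 / 2) (c : ℝ × ℝ) (p : ℤ × ℤ) :
    ∫ x in Set.Ioc (0 : ℝ) 1 ×ˢ Set.Ioc (0 : ℝ) 1,
      cexp (-(2 * π * I * (p.1 * x.1 + p.2 * x.2))) * KR R c x =
    ∫ x in {x : ℝ × ℝ | enorm2 (c - x) ≤ R}, cexp (-(2 * π * I * (p.1 * x.1 + p.2 * x.2))) := by
  set e : ℝ × ℝ → ℂ := fun x => cexp (-(2 * π * I * (p.1 * x.1 + p.2 * x.2)))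
  set Q : Set (ℝ × ℝ) := Set.Ioc (0 : ℝ) 1 ×ˢ Set.Ioc (0 : ℝ) 1
  set D : ℤ × ℤ → Set (ℝ × ℝ) := fun k => {x | enorm2 (c + ((k.1 : ℝ), (k.2 : ℝ)) - x) ≤ R} with hD
  have hQm : MeasurableSet Q := measurableSet_Ioc.prod measurableSet_Ioc
  have hDm (k) : MeasurableSet (D k) := measurableSet_enorm2_sub_le _ _
  have hec : Continuous e := by fun_prop
  set B : Set (ℝ × ℝ) := {x | enorm2 (c - x) ≤ R}
  have hBm : MeasurableSet B := measurableSet_enorm2_sub_le _ _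
  have hQi : IntegrableOn e Q := (hec.continuousOn.integrableOn_compact
    (isCompact_Icc.prod isCompact_Icc)).mono_set
      (Set.prod_mono Set.Ioc_subset_Icc_self Set.Ioc_subset_Icc_self)
  have hBi : IntegrableOn e B := by
    refine (hec.continuousOn.integrableOn_compact (isCompact_closedBall c R)).mono_set ?_
    intro x hx
    rw [Metric.mem_closedBall, dist_comm, dist_eq_norm, Prod.norm_def]
    refine le_trans (max_le ?_ ?_) hx
    · exact Real.abs_le_sqrt (by simp; positivity)
    · exact Real.abs_le_sqrt (by simp; positivity)
  let T : ℤ × ℤ → Set (ℝ × ℝ) := fun k => B ∩ {x | x + ((k.1 : ℝ), (k.2 : ℝ)) ∈ Q}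
  have hTm (k) : MeasurableSet (T k) := hBm.inter ((measurable_add_const _) hQm)
  have hTB : ⋃ k, T k = B := by
    rw [← Set.inter_iUnion, Set.inter_eq_left]
    intro x _
    obtain ⟨m, hm, -⟩ := existsUnique_add_zsmul_mem_Ioc one_pos x.1 0
    obtain ⟨n, hn, -⟩ := existsUnique_add_zsmul_mem_Ioc one_pos x.2 0
    refine Set.mem_iUnion.2 ⟨(m, n), ?_⟩
    simp only [zero_add, zsmul_eq_mul, mul_one] at hm hn
    exact ⟨hm, hn⟩
  have hTd : Pairwise (Function.onFun Disjoint T) := by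
    intro k k' hne
    refine Set.disjoint_left.2 fun x hx hx' => hne ?_
    have h1 {u : ℝ} {m n : ℤ} (h : u + m ∈ Set.Ioc (0 : ℝ) 1) (h' : u + n ∈ Set.Ioc (0 : ℝ) 1) :
        m = n := by
      have h1 : (m : ℝ) < n + 1 := by linarith [h.1, h.2, h'.1, h'.2]
      have h2 : (n : ℝ) < m + 1 := by linarith [h.1, h.2, h'.1, h'.2]
      norm_cast at h1 h2
      omega
    exact Prod.ext (h1 hx.2.1 hx'.2.1) (h1 hx.2.2 hx'.2.2)
  have hleft : HasSum (fun k => ∫ x in Q ∩ D k, e x) (∫ x in Q, e x * KR R c x) := by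
    have h := hasSum_integral_iUnion (f := e) (μ := volume) (s := fun k => Q ∩ D k)
      (fun k => hQm.inter (hDm k))
      (fun k k' hne => (pairwise_disjoint_translates hR c hne).mono Set.inter_subset_right
        Set.inter_subset_right)
      (hQi.mono_set (Set.iUnion_subset fun k => Set.inter_subset_left))
    rw [← Set.inter_iUnion, ← setIntegral_indicator (.iUnion hDm)] at h
    have hfun : (fun x => e x * KR R c x) = (⋃ k, D k).indicator e := by
      funext x
      simp only [KR_eq_indicator hR, Set.indicator, D]
      split_ifs <;> simp
    rwa [hfun]
  have hright : HasSum (fun k => ∫ x in T k, e x) (∫ x in B, e x) := by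
    have h := hasSum_integral_iUnion (f := e) (μ := volume) hTm hTd (by rwa [hTB])
    rwa [hTB] at h
  refine hleft.unique ?_
  convert hright using 2 with k
  rw [← (measurePreserving_add_right volume ((k.1 : ℝ), (k.2 : ℝ))).setIntegral_preimage_emb
    (measurableEmbedding_addRight _)]
  have hpre : (· + ((k.1 : ℝ), (k.2 : ℝ))) ⁻¹' (Q ∩ D k) = T k := by
    ext x
    simp only [hD, T, B, Set.mem_preimage, Set.mem_inter_iff, Set.mem_ofPred_eq,
      add_sub_add_right_eq_sub]
    exact and_comm
  rw [hpre]
  congr 1 with x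
  exact exp_neg_add_int p k x

theorem integral_disk_center (R : ℝ) (c : ℝ × ℝ) (p : ℤ × ℤ) :
    ∫ x in {x : ℝ × ℝ | enorm2 (c - x) ≤ R}, cexp (-(2 * π * I * (p.1 * x.1 + p.2 * x.2))) =
    cexp (-(2 * π * I * (p.1 * c.1 + p.2 * c.2))) *
      ∫ y in {y : ℝ × ℝ | enorm2 y ≤ R},
        cexp (I * ((2 * π * p.1 : ℝ) * y.1 + (2 * π * p.2 : ℝ) * y.2)) := by
  have hm : MeasurableSet {y : ℝ × ℝ | enorm2 y ≤ R} := by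
    unfold enorm2; exact measurableSet_le (by fun_prop) (by fun_prop)
  rw [← integral_const_mul, ← integral_indicator (measurableSet_enorm2_sub_le R c),
    ← integral_indicator hm]
  refine Eq.trans ?_ (integral_sub_left_eq_self (_ : ℝ × ℝ → ℂ) volume c)
  congr 1 with x
  simp only [Set.indicator, Set.mem_ofPred_eq, ← Complex.exp_add]
  congr 2
  push_cast [Prod.fst_sub, Prod.snd_sub]
  ring

theorem conj_kloostermanS (q : ℕ) (m n : ℤ) :
    (starRingEnd ℂ) (kloostermanS q m n) = kloostermanS q (-m) (-n) := by
  rw [kloostermanS, kloostermanS, map_sum]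
  refine Finset.sum_congr rfl fun d _ => ?_
  rw [← Complex.exp_conj]
  congr 1
  simp [Complex.conj_ofNat]
  ring

theorem kloostermanS_neg_neg {q : ℕ} (hq : 0 < q) (m n : ℤ) :
    kloostermanS q (-m) (-n) = kloostermanS q m n := by
  have : NeZero q := ⟨hq.ne'⟩
  have hchar (m n : ℤ) : kloostermanS q m n =
      ∑ d ∈ (Finset.range q).filter (fun d => Nat.Coprime d q),
        ZMod.stdAddChar ((m : ZMod q) * (d : ZMod q) + (n : ZMod q) * (d : ZMod q)⁻¹) := by
    refine Finset.sum_congr rfl fun d _ => ?_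
    rw [← mul_div_assoc, ← ZMod.stdAddChar_coe]
    simp
  rw [hchar, hchar]
  have hmaps : ∀ d ∈ (Finset.range q).filter (fun d => Nat.Coprime d q),
      (-(d : ZMod q)).val ∈ (Finset.range q).filter (fun d => Nat.Coprime d q) := by
    intro d hd
    rw [Finset.mem_filter, Finset.mem_range] at hd ⊢
    refine ⟨ZMod.val_lt _, ?_⟩
    rw [← ZMod.isUnit_iff_coprime, ZMod.natCast_zmod_val]
    exact ((ZMod.isUnit_iff_coprime d q).2 hd.2).neg
  have hinv : ∀ d ∈ (Finset.range q).filter (fun d => Nat.Coprime d q),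
      (-(((-(d : ZMod q)).val : ℕ) : ZMod q)).val = d := by
    intro d hd
    rw [ZMod.natCast_zmod_val, neg_neg, ZMod.val_natCast_of_lt]
    exact Finset.mem_range.1 (Finset.mem_filter.1 hd).1
  refine Finset.sum_nbij' (fun d => (-(d : ZMod q)).val) (fun d => (-(d : ZMod q)).val)
    hmaps hmaps hinv hinv ?_
  intro d hd
  obtain ⟨u, hu⟩ := (ZMod.isUnit_iff_coprime d q).2 (Finset.mem_filter.1 hd).2
  have hneg : (-(d : ZMod q))⁻¹ = -(d : ZMod q)⁻¹ := by
    rw [← hu, ← Units.val_neg, ZMod.inv_coe_unit, ZMod.inv_coe_unit, inv_neg, Units.val_neg]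
  rw [ZMod.natCast_zmod_val, hneg]
  push_cast
  ring_nf

theorem kloostermanS_sq {q : ℕ} (hq : 0 < q) (m n : ℤ) :
    kloostermanS q m n ^ 2 = ((‖kloostermanS q m n‖ ^ 2 : ℝ) : ℂ) := by
  push_cast
  rw [← Complex.mul_conj', conj_kloostermanS, kloostermanS_neg_neg hq, sq]

theorem tsum_disk_series_zero (R : ℝ) :
    ∑' j : ℕ, (-1) ^ j * π / (j.factorial * (j + 1).factorial) *
      ((0 : ℝ) / 2) ^ (2 * j) * R ^ (2 * j + 2) = π * R ^ 2 := by
  rw [tsum_eq_single 0]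
  · simp
  · intro j hj
    simp [hj]

theorem tsum_disk_series_eq_besselJ1 (R : ℝ) {k : ℝ} (hk : k ≠ 0) :
    ∑' j : ℕ, (-1) ^ j * π / (j.factorial * (j + 1).factorial) *
      (2 * π * k / 2) ^ (2 * j) * R ^ (2 * j + 2) = R / k * besselJ1 (2 * π * R * k) := by
  rw [besselJ1, ← tsum_mul_left]
  congr 1 with j
  have := Nat.cast_ne_zero (R := ℝ).2 (Nat.factorial_ne_zero j)
  have := Nat.cast_ne_zero (R := ℝ).2 (Nat.factorial_ne_zero (j + 1))
  field_simp
  ring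

theorem integral_unit_square_exp (p : ℤ × ℤ) :
    ∫ x in Set.Ioc (0 : ℝ) 1 ×ˢ Set.Ioc (0 : ℝ) 1, cexp (-(2 * π * I * (p.1 * x.1 + p.2 * x.2))) =
      if p = 0 then 1 else 0 := by
  have h1 (n : ℤ) : ∫ t in Set.Ioc (0 : ℝ) 1, cexp (-(2 * π * I * n) * t) =
      if n = 0 then 1 else 0 := by
    split_ifs with h
    · simp [h]
    · have hc : -(2 * π * I * n) ≠ 0 := by simp [h, pi_ne_zero]
      rw [← intervalIntegral.integral_of_le zero_le_one, integral_exp_mul_complex hc]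
      have : cexp (-(2 * π * I * n)) = 1 := by
        rw [Complex.exp_eq_one_iff]
        exact ⟨-n, by push_cast; ring⟩
      simp [this]
  have h2 (x : ℝ × ℝ) : cexp (-(2 * π * I * (p.1 * x.1 + p.2 * x.2))) =
      cexp (-(2 * π * I * p.1) * x.1) * cexp (-(2 * π * I * p.2) * x.2) := by
    rw [← Complex.exp_add]; congr 1; ring
  simp only [h2]
  rw [Measure.volume_eq_prod, setIntegral_prod_mul (fun s : ℝ => cexp (-(2 * π * I * p.1) * s))
    (fun s : ℝ => cexp (-(2 * π * I * p.2) * s)), h1, h1]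
  by_cases h1 : p.1 = 0 <;> by_cases h2 : p.2 = 0 <;> simp [Prod.ext_iff, h1, h2]

theorem norm_sq_integral_unit_square_muVal {q : ℕ} (hq : 0 < q) {R : ℝ} (hR0 : 0 < R)
    (hR : R < 1 / 2) (p : ℤ × ℤ) :
    ‖∫ x in Set.Ioc (0 : ℝ) 1 ×ˢ Set.Ioc (0 : ℝ) 1,
        cexp (-(2 * π * I * (p.1 * x.1 + p.2 * x.2))) * ((muVal q R x - π * R ^ 2 : ℝ) : ℂ)‖ ^ 2 =
    R ^ 2 / (q.totient : ℝ) ^ 2 * if p = 0 then 0 else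
      besselJ1 (2 * π * R * √((p.1 : ℝ) ^ 2 + (p.2 : ℝ) ^ 2)) ^ 2
        / ((p.1 : ℝ) ^ 2 + (p.2 : ℝ) ^ 2) * ‖kloostermanS q p.1 p.2‖ ^ 2 := by
  set Q : Set (ℝ × ℝ) := Set.Ioc (0 : ℝ) 1 ×ˢ Set.Ioc (0 : ℝ) 1
  set e : ℝ × ℝ → ℂ := fun x => cexp (-(2 * π * I * (p.1 * x.1 + p.2 * x.2)))
  have hec : Continuous e := by fun_prop
  have hQi : IntegrableOn e Q := (hec.continuousOn.integrableOn_compact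
    (isCompact_Icc.prod isCompact_Icc)).mono_set
      (Set.prod_mono Set.Ioc_subset_Icc_self Set.Ioc_subset_Icc_self)
  have hφ : (q.totient : ℂ) ≠ 0 := Nat.cast_ne_zero.2 (Nat.totient_pos.2 hq).ne'
  set s := √((p.1 : ℝ) ^ 2 + (p.2 : ℝ) ^ 2) with hs
  set V : ℝ := ∑' j : ℕ, (-1) ^ j * π / (j.factorial * (j + 1).factorial) *
      (2 * π * s / 2) ^ (2 * j) * R ^ (2 * j + 2) with hV
  have hKR (c : ℝ × ℝ) : ∫ x in Q, e x * KR R c x = e c * V := by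
    rw [integral_unit_square_KR hR, integral_disk_center, integral_disk_exp hR0.le]
    have : √((2 * π * p.1) ^ 2 + (2 * π * p.2) ^ 2) = 2 * π * s := by
      rw [mul_pow, mul_pow _ (p.2 : ℝ), ← mul_add, Real.sqrt_mul (by positivity),
        Real.sqrt_sq (by positivity)]
    rw [this]
  have hKRi (c : ℝ × ℝ) : IntegrableOn (fun x => e x * KR R c x) Q :=
    Integrable.mul_bdd (c := 1) hQi (measurable_KR hR c).complex_ofReal.aestronglyMeasurable
      (.of_forall fun x => by rw [norm_real]; exact norm_KR_le_one hR c x)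
  set A : Finset ℕ := (Finset.range q).filter (fun d => Nat.Coprime d q)
  set c : ℕ → ℝ × ℝ := fun d => ((d : ℝ) / q, ((((d : ZMod q)⁻¹).val : ℕ) : ℝ) / q)
  have hsum : ∑ d ∈ A, e (c d) = kloostermanS q (-p.1) (-p.2) := by
    refine Finset.sum_congr rfl fun d _ => ?_
    simp only [e, c]
    congr 1
    push_cast
    ring
  have hintegral : ∫ x in Q, e x * ((muVal q R x - π * R ^ 2 : ℝ) : ℂ) =
      1 / (q.totient : ℂ) * (V * kloostermanS q p.1 p.2) - π * R ^ 2 * if p = 0 then 1 else 0 := by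
    rw [← integral_unit_square_exp, ← kloostermanS_neg_neg hq, ← hsum, Finset.mul_sum,
      ← integral_const_mul]
    simp only [mul_comm (V : ℂ), ← hKR]
    rw [← integral_finsetSum _ fun d _ => hKRi (c d), ← integral_const_mul, ← integral_sub]
    · congr 1 with x
      simp only [muVal]
      push_cast
      rw [mul_sub, mul_left_comm, Finset.mul_sum, mul_comm (e x)]
    · exact (integrable_finsetSum _ fun d _ => hKRi (c d)).const_mul _
    · exact hQi.const_mul _
  rw [hintegral]
  split_ifs with hp
  · have hs0 : s = 0 := by simp [s, hp]
    have hV0 : V = π * R ^ 2 := by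
      rw [hV, hs0, mul_zero, tsum_disk_series_zero]
    have hS : kloostermanS q 0 0 = q.totient := by
      rw [Nat.totient_eq_card_coprime]
      simp [kloostermanS, Nat.coprime_comm]
    simp only [hp, hV0, Prod.fst_zero, Prod.snd_zero, hS]
    push_cast
    field_simp
    simp
  · have hpos : 0 < (p.1 : ℝ) ^ 2 + (p.2 : ℝ) ^ 2 := by
      rcases not_and_or.1 (fun h => hp (Prod.ext_iff.2 h)) with h | h
      · have : (p.1 : ℝ) ≠ 0 := by exact_mod_cast h
        positivity
      · have : (p.2 : ℝ) ≠ 0 := by exact_mod_cast h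
        positivity
    have hs0 : 0 < s := Real.sqrt_pos.2 hpos
    rw [hV, tsum_disk_series_eq_besselJ1 R hs0.ne', ← Real.sq_sqrt hpos.le, ← hs]
    simp only [mul_zero, sub_zero, norm_mul, norm_div, norm_one, Complex.norm_natCast, norm_real,
      mul_pow, div_pow, Real.norm_eq_abs, sq_abs]
    ring

theorem variance_spectral_expansion (q : ℕ) (hq : 0 < q) (R : ℝ) (hR0 : 0 < R)
    (hR : R < 1 / 2) :
    (varMu q R : ℂ) = ((R : ℂ) ^ 2 / (q.totient : ℂ) ^ 2) *
      ∑' p : ℤ × ℤ,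
        (if p = 0 then (0 : ℂ)
          else ((besselJ1 (2 * Real.pi * R * Real.sqrt ((p.1 : ℝ) ^ 2 + (p.2 : ℝ) ^ 2)) ^ 2
              / ((p.1 : ℝ) ^ 2 + (p.2 : ℝ) ^ 2) : ℝ) : ℂ) * (kloostermanS q p.1 p.2) ^ 2) := by
  have hmeas : Measurable fun x => ((muVal q R x - π * R ^ 2 : ℝ) : ℂ) := by
    have : Measurable (muVal q R) :=
      (Finset.measurable_sum _ fun d _ => by
        exact measurable_KR hR _).const_mul _
    exact (this.sub_const _).complex_ofReal
  have hbound (x : ℝ × ℝ) : ‖((muVal q R x - π * R ^ 2 : ℝ) : ℂ)‖ ≤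
      ‖1 / (q.totient : ℝ)‖ * (q * 1) + ‖π * R ^ 2‖ := by
    rw [norm_real]
    refine (norm_sub_le _ _).trans (add_le_add_left ?_ _)
    rw [muVal, norm_mul]
    refine mul_le_mul_of_nonneg_left ((norm_sum_le_of_le _ fun d _ => norm_KR_le_one hR _ x).trans ?_)
      (norm_nonneg _)
    rw [Finset.sum_const, nsmul_eq_mul]
    gcongr
    exact (Finset.card_filter_le _ _).trans (Finset.card_range q).le
  have h := (hasSum_sq_norm_integral_unit_square hmeas hbound).tsum_eq
  simp only [norm_sq_integral_unit_square_muVal hq hR0 hR, norm_real, Real.norm_eq_abs, sq_abs] at h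
  rw [varMu, ← h, tsum_mul_left]
  push_cast
  congr 2 with p
  split_ifs
  · simp
  · rw [kloostermanS_sq hq]
    push_cast
    rfl
end
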